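/- (Converse part of Theorem 2.) Let ψ_1, …, ψ_n be unit vectors in ℂ^d with probability weights p_i ≥ 0 summing to 1 and Π_i = |ψ_i⟩⟨ψ_i|. If the ensemble is NOT a generalized 2-design, i.e. Σ_i p_i (Π_i ⊗ Π_i) ≠ (1/(d(d+1)))·(I + SWAP), then there exist a finite POVM {E_b}_{b=1}^m and density matrices {σ_b}_{b=1}^m such that the average fidelity satisfies Σ_{b,i} p_i · Tr(Π_i E_b) · Tr(Π_i σ_b) > 2/(d+1). -/

import Mathlib

open Matrix Kronecker BigOperators
open scoped ComplexOrder

/-- The rank-one projector `|ψ⟩⟨ψ|` onto a vector `ψ ∈ ℂ^d`. -/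
noncomputable def proj {d : ℕ} (ψ : Fin d → ℂ) : Matrix (Fin d) (Fin d) ℂ :=
  vecMulVec ψ (star ψ)

/-- The swap operator on `ℂ^d ⊗ ℂ^d`, mapping `u ⊗ v` to `v ⊗ u`. -/
def swapMatrix (d : ℕ) : Matrix (Fin d × Fin d) (Fin d × Fin d) ℂ :=
  Matrix.of fun p q => if p.1 = q.2 ∧ p.2 = q.1 then 1 else 0

/-- The squared Euclidean norm of a vector of `ℂ^d`. -/
noncomputable def vecNormSq {d : ℕ} (x : Fin d → ℂ) : ℝ :=
  ∑ j, Complex.normSq (x j)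

/-- The squared overlap of `ψ` with the normalization of `x`. -/
noncomputable def overlap {d : ℕ} (ψ x : Fin d → ℂ) : ℝ :=
  Complex.normSq (star ψ ⬝ᵥ x) / vecNormSq x

lemma ofReal_vecNormSq {d : ℕ} (x : Fin d → ℂ) :
    ((vecNormSq x : ℝ) : ℂ) = star x ⬝ᵥ x := by
  simp [vecNormSq, dotProduct, Complex.normSq_eq_conj_mul_self]

lemma vecNormSq_nonneg {d : ℕ} (x : Fin d → ℂ) : 0 ≤ vecNormSq x :=
  Finset.sum_nonneg fun _ _ => Complex.normSq_nonneg _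

lemma vecNormSq_pos {d : ℕ} {x : Fin d → ℂ} (hx : x ≠ 0) : 0 < vecNormSq x := by
  refine lt_of_le_of_ne (vecNormSq_nonneg x) fun h => hx ?_
  have := (Finset.sum_eq_zero_iff_of_nonneg
    (fun j _ => Complex.normSq_nonneg (x j))).1 h.symm
  funext j
  simpa using this j (Finset.mem_univ j)

lemma vecNormSq_smul {d : ℕ} (c : ℂ) (x : Fin d → ℂ) :
    vecNormSq (c • x) = Complex.normSq c * vecNormSq x := by
  simp [vecNormSq, Finset.mul_sum]

lemma overlap_smul {d : ℕ} (ψ x : Fin d → ℂ) {c : ℂ} (hc : c ≠ 0) :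
    overlap ψ (c • x) = overlap ψ x := by
  have : Complex.normSq c ≠ 0 := by simpa using hc
  simp only [overlap, vecNormSq_smul, dotProduct_smul, smul_eq_mul, map_mul]
  exact mul_div_mul_left _ _ this

lemma trace_proj_mul_proj {d : ℕ} (ψ x : Fin d → ℂ) :
    (proj ψ * proj x).trace = (Complex.normSq (star ψ ⬝ᵥ x) : ℂ) := by
  have h : star x ⬝ᵥ ψ = star (star ψ ⬝ᵥ x) := star_dotProduct x ψ
  rw [proj, proj, vecMulVec_mul_vecMulVec, vecMulVec_smul, trace_smul, trace_vecMulVec, dotProduct_comm ψ,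
    h, Complex.normSq_eq_conj_mul_self, smul_eq_mul, mul_comm]
  rfl

lemma trace_proj {d : ℕ} (x : Fin d → ℂ) : (proj x).trace = (vecNormSq x : ℂ) := by
  rw [proj, trace_vecMulVec, dotProduct_comm, ofReal_vecNormSq]

lemma posSemidef_proj {d : ℕ} (x : Fin d → ℂ) : (proj x).PosSemidef :=
  posSemidef_vecMulVec_self_star x

lemma proj_mulVec {d : ℕ} (U : Matrix (Fin d) (Fin d) ℂ) (x : Fin d → ℂ) :
    proj (U *ᵥ x) = U * proj x * Uᴴ := by
  rw [proj, proj, star_mulVec, mul_vecMulVec, vecMulVec_mul]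

/-! ### The fourth roots of unity and an explicit weighted 2-design -/

/-- The fourth roots of unity. -/
noncomputable def phase : Fin 4 → ℂ := ![1, -1, Complex.I, -Complex.I]

lemma normSq_phase (k : Fin 4) : Complex.normSq (phase k) = 1 := by
  fin_cases k <;> simp [phase]

lemma sum_phase_mul (a b s t : ℂ) :
    ∑ k, (star (phase k) * a + s) * star (star (phase k) * b + t) =
      4 * (a * star b + s * star t) := by
  simp only [Fin.sum_univ_four, phase]
  simp
  linear_combination (-2 * a * (starRingEnd ℂ) b) * Complex.I_sq

lemma sum_phase_normSq_sq (a s : ℂ) :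
    ∑ k, Complex.normSq (star (phase k) * a + s) ^ 2 =
      4 * (Complex.normSq a ^ 2 + 4 * Complex.normSq a * Complex.normSq s
        + Complex.normSq s ^ 2) := by
  simp only [Fin.sum_univ_four, phase]
  simp [Complex.normSq_apply]
  ring

/-- The vector whose coordinates are the phases selected by `k`. -/
noncomputable def phaseVec {d : ℕ} (k : Fin d → Fin 4) : Fin d → ℂ := fun j => phase (k j)

lemma vecNormSq_phaseVec {d : ℕ} (k : Fin d → Fin 4) : vecNormSq (phaseVec k) = d := by
  simp [vecNormSq, phaseVec, normSq_phase]

lemma sum_fin_succ_pi {M : Type*} [AddCommMonoid M] {d m : ℕ} (f : (Fin (d + 1) → Fin m) → M) :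
    ∑ k, f k = ∑ k : Fin d → Fin m, ∑ a : Fin m, f (Fin.cons a k) := by
  rw [← (Fin.consEquiv (fun _ : Fin (d + 1) => Fin m)).sum_comp, Fintype.sum_prod_type,
    Finset.sum_comm]
  rfl

lemma star_phaseVec_cons_dotProduct {d : ℕ} (a : Fin 4) (k : Fin d → Fin 4)
    (z : Fin (d + 1) → ℂ) :
    star (phaseVec (Fin.cons a k : Fin (d + 1) → Fin 4)) ⬝ᵥ z =
      star (phase a) * z 0 + star (phaseVec k) ⬝ᵥ (fun j => z j.succ) := by
  simp [dotProduct, phaseVec, Fin.sum_univ_succ]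

lemma sum_phaseVec_mul {d : ℕ} (y z : Fin d → ℂ) :
    ∑ k : Fin d → Fin 4, (star (phaseVec k) ⬝ᵥ z) * star (star (phaseVec k) ⬝ᵥ y) =
      4 ^ d * ∑ j, z j * star (y j) := by
  induction d with
  | zero => simp
  | succ d ih =>
    simp only [sum_fin_succ_pi, star_phaseVec_cons_dotProduct, sum_phase_mul]
    rw [← Finset.mul_sum, Finset.sum_add_distrib, ih, Fin.sum_univ_succ]
    simp
    ring

lemma sum_phaseVec_normSq {d : ℕ} (z : Fin d → ℂ) :
    ∑ k : Fin d → Fin 4, Complex.normSq (star (phaseVec k) ⬝ᵥ z) = 4 ^ d * vecNormSq z := by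
  have h := sum_phaseVec_mul z z
  simp only [Complex.star_def, Complex.mul_conj] at h
  exact_mod_cast h

lemma sum_phaseVec_normSq_sq {d : ℕ} (z : Fin d → ℂ) :
    ∑ k : Fin d → Fin 4, Complex.normSq (star (phaseVec k) ⬝ᵥ z) ^ 2 =
      4 ^ d * (2 * vecNormSq z ^ 2 - ∑ j, Complex.normSq (z j) ^ 2) := by
  induction d with
  | zero => simp [vecNormSq]
  | succ d ih =>
    simp only [sum_fin_succ_pi, star_phaseVec_cons_dotProduct, sum_phase_normSq_sq]
    rw [← Finset.mul_sum, Finset.sum_add_distrib, Finset.sum_add_distrib, ih, ← Finset.mul_sum,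
      sum_phaseVec_normSq, Fin.sum_univ_succ, vecNormSq, vecNormSq, Fin.sum_univ_succ]
    simp
    ring

lemma sum_proj_phaseVec (d : ℕ) :
    ∑ k : Fin d → Fin 4, proj (phaseVec k) = (4 : ℂ) ^ d • (1 : Matrix (Fin d) (Fin d) ℂ) := by
  ext i j
  have h := sum_phaseVec_mul (Pi.single i 1) (Pi.single j (1 : ℂ))
  simp only [dotProduct_single, mul_one, Pi.star_apply, star_star] at h
  simp only [Matrix.sum_apply, proj, vecMulVec_apply, Pi.star_apply, Matrix.smul_apply,
    Matrix.one_apply, smul_eq_mul]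
  rw [Finset.sum_congr rfl fun k _ => mul_comm _ _, h]
  simp [Pi.single_apply, eq_comm]

lemma sum_proj_single (d : ℕ) :
    ∑ j : Fin d, proj (Pi.single j 1) = (1 : Matrix (Fin d) (Fin d) ℂ) := by
  ext a b
  simp [Matrix.sum_apply, proj, vecMulVec_apply, Pi.single_apply, Matrix.one_apply]

/-- The vectors of the design. -/
noncomputable def designVec (d : ℕ) : (Fin d → Fin 4) ⊕ Fin d → Fin d → ℂ :=
  Sum.elim phaseVec fun j => Pi.single j 1

/-- The weights of the design. -/
noncomputable def designWeight (d : ℕ) : (Fin d → Fin 4) ⊕ Fin d → ℝ :=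
  Sum.elim (fun _ => d / ((d + 1) * 4 ^ d)) fun _ => 1 / (d + 1)

lemma designWeight_nonneg (d : ℕ) (s : (Fin d → Fin 4) ⊕ Fin d) : 0 ≤ designWeight d s := by
  rcases s with s | s <;> simp only [designWeight, Sum.elim_inl, Sum.elim_inr] <;> positivity

lemma sum_designWeight_proj (d : ℕ) :
    ∑ s, (designWeight d s : ℂ) • proj (designVec d s) = 1 := by
  have h : (d : ℂ) + 1 ≠ 0 := by exact_mod_cast d.succ_ne_zero
  rw [Fintype.sum_sum_type]
  simp only [designWeight, designVec, Sum.elim_inl, Sum.elim_inr]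
  rw [← Finset.smul_sum, ← Finset.smul_sum, sum_proj_phaseVec, sum_proj_single, smul_smul,
    ← add_smul]
  convert one_smul ℂ (1 : Matrix (Fin d) (Fin d) ℂ) using 2
  push_cast
  field_simp

lemma vecNormSq_single {d : ℕ} (j : Fin d) : vecNormSq (Pi.single j (1 : ℂ)) = 1 := by
  simp [vecNormSq, Pi.single_apply, apply_ite]

lemma normSq_star_dotProduct_comm {d : ℕ} (x y : Fin d → ℂ) :
    Complex.normSq (star x ⬝ᵥ y) = Complex.normSq (star y ⬝ᵥ x) := by
  rw [show star x ⬝ᵥ y = star (star y ⬝ᵥ x) from star_dotProduct x y]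
  exact Complex.normSq_conj _

lemma designVec_ne_zero {d : ℕ} (hd : 0 < d) (s : (Fin d → Fin 4) ⊕ Fin d) :
    designVec d s ≠ 0 := by
  intro h
  have h2 : vecNormSq (designVec d s) = 0 := by simp [h, vecNormSq]
  rcases s with s | s <;> simp only [designVec, Sum.elim_inl, Sum.elim_inr] at h2
  · rw [vecNormSq_phaseVec] at h2
    exact hd.ne' (by exact_mod_cast h2)
  · simp [vecNormSq_single] at h2

lemma sum_design_overlap {d : ℕ} (hd : 0 < d) (z : Fin d → ℂ) :
    ∑ s, designWeight d s * Complex.normSq (star z ⬝ᵥ designVec d s) * overlap z (designVec d s) =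
      2 / (d + 1) * vecNormSq z ^ 2 := by
  have h0 : (0 : ℝ) < d := by exact_mod_cast hd
  rw [Fintype.sum_sum_type]
  simp only [designWeight, designVec, overlap, Sum.elim_inl, Sum.elim_inr, vecNormSq_phaseVec,
    vecNormSq_single]
  have h1 : ∑ k : Fin d → Fin 4, (d : ℝ) / ((d + 1) * 4 ^ d) *
      Complex.normSq (star z ⬝ᵥ phaseVec k) * (Complex.normSq (star z ⬝ᵥ phaseVec k) / d) =
      1 / ((d + 1) * 4 ^ d) * ∑ k : Fin d → Fin 4, Complex.normSq (star (phaseVec k) ⬝ᵥ z) ^ 2 := by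
    rw [Finset.mul_sum]
    refine Finset.sum_congr rfl fun k _ => ?_
    rw [normSq_star_dotProduct_comm]
    field_simp
  rw [h1, sum_phaseVec_normSq_sq]
  simp only [dotProduct_single, mul_one, div_one, Pi.star_apply, Complex.star_def,
    Complex.normSq_conj]
  have h2 : ∑ j, (1 : ℝ) / (d + 1) * Complex.normSq (z j) * Complex.normSq (z j) =
      1 / (d + 1) * ∑ j, Complex.normSq (z j) ^ 2 := by
    rw [Finset.mul_sum]
    exact Finset.sum_congr rfl fun j _ => by ring
  rw [h2]
  field_simp
  ring

lemma sum_designWeight_vecNormSq (d : ℕ) :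
    ∑ s, designWeight d s * vecNormSq (designVec d s) = d := by
  have h := congrArg Matrix.trace (sum_designWeight_proj d)
  simp only [trace_sum, trace_smul, trace_proj, trace_one, Fintype.card_fin, smul_eq_mul] at h
  exact_mod_cast h

/-! ### Rotating the design -/

lemma exists_unitary_mulVec_single {d : ℕ} (j₀ : Fin d) {x : Fin d → ℂ} (hx : vecNormSq x = 1) :
    ∃ U : Matrix (Fin d) (Fin d) ℂ, U * Uᴴ = 1 ∧ U *ᵥ Pi.single j₀ 1 = x := by
  have hnorm : ‖(WithLp.toLp 2 x : EuclideanSpace ℂ (Fin d))‖ = 1 := by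
    rw [EuclideanSpace.norm_eq, Real.sqrt_eq_one, ← hx]
    simp [vecNormSq, Complex.normSq_eq_norm_sq]
  obtain ⟨b, hb⟩ := Orthonormal.exists_orthonormalBasis_extension_of_card_eq
    (𝕜 := ℂ) (E := EuclideanSpace ℂ (Fin d)) (ι := Fin d) (by simp)
    (v := fun _ => WithLp.toLp 2 x) (s := {j₀}) (by
      rw [orthonormal_iff_ite]
      rintro ⟨i, hi⟩ ⟨j, hj⟩
      have hi' : i = j₀ := hi
      have hj' : j = j₀ := hj
      subst hi' hj'
      simp [hnorm])
  refine ⟨Matrix.of fun i j => b j i, ?_, ?_⟩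
  · rw [mul_eq_one_comm]
    ext i j
    have := orthonormal_iff_ite.1 b.orthonormal i j
    rw [PiLp.inner_apply] at this
    simp only [Matrix.mul_apply, conjTranspose_apply, Matrix.of_apply, Matrix.one_apply]
    rw [← this]
    exact Finset.sum_congr rfl fun k _ => by simp [mul_comm]
  · ext i
    simp [hb j₀ rfl]

lemma star_dotProduct_mulVec {d : ℕ} (U : Matrix (Fin d) (Fin d) ℂ) (ψ x : Fin d → ℂ) :
    star ψ ⬝ᵥ (U *ᵥ x) = star (Uᴴ *ᵥ ψ) ⬝ᵥ x := by
  rw [star_mulVec, conjTranspose_conjTranspose, dotProduct_mulVec]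

lemma vecNormSq_mulVec {d : ℕ} {U : Matrix (Fin d) (Fin d) ℂ} (hU : Uᴴ * U = 1) (x : Fin d → ℂ) :
    vecNormSq (U *ᵥ x) = vecNormSq x := by
  have : ((vecNormSq (U *ᵥ x) : ℝ) : ℂ) = vecNormSq x := by
    rw [ofReal_vecNormSq, ofReal_vecNormSq, star_dotProduct_mulVec, mulVec_mulVec, hU, one_mulVec]
  exact_mod_cast this

/-- The fidelity of the measure-and-prepare strategy with effects `w s • |φ s⟩⟨φ s|` that prepares
the normalization of `χ s`. -/
lemma exists_strategy_of_vectors {d n : ℕ} (ψ : Fin n → Fin d → ℂ) (p : Fin n → ℝ)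
    {ι : Type} [Fintype ι] (w : ι → ℝ) (hw : ∀ s, 0 ≤ w s) (φ χ : ι → Fin d → ℂ)
    (hχ : ∀ s, χ s ≠ 0) (hφ : ∑ s, (w s : ℂ) • proj (φ s) = 1) :
    ∃ (m : ℕ) (E : Fin m → Matrix (Fin d) (Fin d) ℂ)
      (σ : Fin m → Matrix (Fin d) (Fin d) ℂ),
      (∀ b, (E b).PosSemidef) ∧ (∑ b, E b = 1) ∧
      (∀ b, (σ b).PosSemidef) ∧ (∀ b, (σ b).trace = 1) ∧
      ∑ b, ∑ i, p i * (proj (ψ i) * E b).trace.re * (proj (ψ i) * σ b).trace.re =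
        ∑ s, ∑ i, p i * (w s * Complex.normSq (star (ψ i) ⬝ᵥ φ s)) * overlap (ψ i) (χ s) := by
  let e := (Fintype.equivFin ι).symm
  refine ⟨Fintype.card ι, fun b => (w (e b) : ℂ) • proj (φ (e b)),
    fun b => ((vecNormSq (χ (e b)))⁻¹ : ℂ) • proj (χ (e b)), fun b => ?_, ?_, fun b => ?_,
    fun b => ?_, ?_⟩
  · exact (posSemidef_proj _).smul (by exact_mod_cast hw _)
  · rw [← hφ]
    exact e.sum_comp fun s => (w s : ℂ) • proj (φ s)
  · exact (posSemidef_proj _).smul (by exact_mod_cast inv_nonneg.2 (vecNormSq_nonneg _))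
  · rw [trace_smul, trace_proj, smul_eq_mul]
    exact inv_mul_cancel₀ (by exact_mod_cast (vecNormSq_pos (hχ _)).ne')
  · rw [← e.sum_comp]
    refine Finset.sum_congr rfl fun b _ => Finset.sum_congr rfl fun i _ => ?_
    simp only [Matrix.mul_smul, trace_smul, trace_proj_mul_proj, smul_eq_mul, overlap,
      ← Complex.ofReal_inv, ← Complex.ofReal_mul, Complex.ofReal_re]
    rw [div_eq_inv_mul]

lemma sum_overlap_mul_le {d n : ℕ} (hd : 0 < d)
    (ψ : Fin n → Fin d → ℂ) (hψ : ∀ i, vecNormSq (ψ i) = 1)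
    (p : Fin n → ℝ) (hp1 : ∑ i, p i = 1)
    (hno : ¬ ∃ (m : ℕ) (E : Fin m → Matrix (Fin d) (Fin d) ℂ)
      (σ : Fin m → Matrix (Fin d) (Fin d) ℂ),
      (∀ b, (E b).PosSemidef) ∧ (∑ b, E b = 1) ∧
      (∀ b, (σ b).PosSemidef) ∧ (∀ b, (σ b).trace = 1) ∧
      2 / ((d : ℝ) + 1) <
        ∑ b, ∑ i, p i * (proj (ψ i) * E b).trace.re * (proj (ψ i) * σ b).trace.re)
    {x y : Fin d → ℂ} (hx : x ≠ 0) (hy : y ≠ 0) :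
    ∑ i, p i * overlap (ψ i) x * overlap (ψ i) y ≤ ∑ i, p i * overlap (ψ i) x ^ 2 := by
  classical
  let j₀ : Fin d := ⟨0, hd⟩
  have hxpos := vecNormSq_pos hx
  have hc : ((Real.sqrt (vecNormSq x))⁻¹ : ℂ) ≠ 0 :=
    inv_ne_zero (by exact_mod_cast (Real.sqrt_pos.2 hxpos).ne')
  set x₁ := ((Real.sqrt (vecNormSq x))⁻¹ : ℂ) • x with hx₁
  have hx₁n : vecNormSq x₁ = 1 := by
    rw [hx₁, vecNormSq_smul, map_inv₀, Complex.normSq_ofReal, Real.mul_self_sqrt hxpos.le,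
      inv_mul_cancel₀ hxpos.ne']
  obtain ⟨U, hU, hUx⟩ := exists_unitary_mulVec_single j₀ hx₁n
  have hU' : Uᴴ * U = 1 := mul_eq_one_comm.1 hU
  let φ := fun s => U *ᵥ designVec d s
  have hφ0 : ∀ s, φ s ≠ 0 := fun s h => by
    have h1 := vecNormSq_mulVec hU' (designVec d s)
    have h2 := vecNormSq_pos (designVec_ne_zero hd s)
    rw [show U *ᵥ designVec d s = 0 from h] at h1
    simp only [vecNormSq, Pi.zero_apply, map_zero, Finset.sum_const_zero] at h1
    exact h2.ne h1
  have hφx : φ (Sum.inr j₀) = x₁ := hUx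
  have hφ1 : ∑ s, (designWeight d s : ℂ) • proj (φ s) = 1 := by
    have h1 : ∀ s, (designWeight d s : ℂ) • proj (φ s) =
        U * ((designWeight d s : ℂ) • proj (designVec d s)) * Uᴴ := fun s => by
      simp [φ, proj_mulVec]
    simp only [h1]
    rw [← Finset.sum_mul, ← Finset.mul_sum, sum_designWeight_proj, mul_one, hU]
  let χ := Function.update φ (Sum.inr j₀) y
  have hχ : ∀ s, χ s ≠ 0 := fun s => by
    by_cases h : s = Sum.inr j₀
    · simpa [h, χ] using hy
    · simpa [h, χ] using hφ0 s
  obtain ⟨m, E, σ, h1, h2, h3, h4, h5⟩ :=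
    exists_strategy_of_vectors ψ p (designWeight d) (designWeight_nonneg d) φ χ hχ hφ1
  have h6 := not_lt.1 fun h => hno ⟨m, E, σ, h1, h2, h3, h4, h⟩
  rw [h5] at h6
  have hbase : ∑ s, ∑ i, p i * (designWeight d s * Complex.normSq (star (ψ i) ⬝ᵥ φ s)) *
      overlap (ψ i) (φ s) = 2 / (d + 1) := by
    rw [Finset.sum_comm]
    have : ∀ i, ∑ s, p i * (designWeight d s * Complex.normSq (star (ψ i) ⬝ᵥ φ s)) *
        overlap (ψ i) (φ s) = p i * (2 / (d + 1)) := fun i => by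
      have hz := sum_design_overlap hd (Uᴴ *ᵥ ψ i)
      rw [vecNormSq_mulVec (by rwa [conjTranspose_conjTranspose]), hψ i] at hz
      rw [one_pow, mul_one] at hz
      rw [← hz, Finset.mul_sum]
      refine Finset.sum_congr rfl fun s _ => ?_
      simp only [overlap, φ, star_dotProduct_mulVec, vecNormSq_mulVec hU']
      ring
    simp only [this]
    rw [← Finset.sum_mul, hp1, one_mul]
  have hdiff := sub_nonpos.2 (h6.trans_eq hbase.symm)
  rw [← Finset.sum_sub_distrib, Finset.sum_eq_single (Sum.inr j₀)] at hdiff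
  · have hov : ∀ i, Complex.normSq (star (ψ i) ⬝ᵥ x₁) = overlap (ψ i) x := fun i => by
      rw [← overlap_smul (ψ i) x hc, ← hx₁, overlap, hx₁n, div_one]
    have hov' : ∀ i, overlap (ψ i) x₁ = overlap (ψ i) x := fun i => overlap_smul _ _ hc
    simp only [hφx, χ, Function.update_self, hov, hov', designWeight, Sum.elim_inr] at hdiff
    have hpos : (0 : ℝ) < d + 1 := by positivity
    have e1 : ∀ t : Fin n → ℝ, ∑ i, p i * (1 / ((d : ℝ) + 1) * overlap (ψ i) x) * t i =
        1 / (d + 1) * ∑ i, p i * overlap (ψ i) x * t i := fun t => by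
      rw [Finset.mul_sum]
      exact Finset.sum_congr rfl fun i _ => by ring
    rw [e1, e1, ← mul_sub] at hdiff
    have := nonpos_of_mul_nonpos_right hdiff (by positivity)
    simp only [pow_two, ← mul_assoc]
    linarith
  · intro s _ hs
    simp [χ, hs]
  · simp

/-! ### Constancy of the fourth moment -/

lemma differentiable_overlap_line {d : ℕ} (ψ u v : Fin d → ℂ)
    (h : ∀ t : ℝ, u + (t : ℂ) • v ≠ 0) :
    Differentiable ℝ fun t : ℝ => overlap ψ (u + (t : ℂ) • v) := by
  unfold overlap
  refine Differentiable.div ?_ ?_ fun t => (vecNormSq_pos (h t)).ne'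
  · simp only [dotProduct_add, dotProduct_smul, Complex.normSq_apply, Complex.add_re,
      Complex.add_im, smul_eq_mul, Complex.re_ofReal_mul, Complex.im_ofReal_mul]
    fun_prop
  · simp only [vecNormSq, Pi.add_apply, Pi.smul_apply, Complex.normSq_apply, Complex.add_re,
      Complex.add_im, smul_eq_mul, Complex.re_ofReal_mul, Complex.im_ofReal_mul]
    fun_prop

lemma sum_overlap_sq_const {d n : ℕ} (ψ : Fin n → Fin d → ℂ) (p : Fin n → ℝ)
    (hle : ∀ x y : Fin d → ℂ, x ≠ 0 → y ≠ 0 →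
      ∑ i, p i * overlap (ψ i) x * overlap (ψ i) y ≤ ∑ i, p i * overlap (ψ i) x ^ 2)
    {u w : Fin d → ℂ} (hu : u ≠ 0) (hw : w ≠ 0) :
    ∑ i, p i * overlap (ψ i) u ^ 2 = ∑ i, p i * overlap (ψ i) w ^ 2 := by
  by_cases h : ∀ t : ℝ, u + (t : ℂ) • (w - u) ≠ 0
  · have hdiff := fun i => differentiable_overlap_line (ψ i) u (w - u) h
    set a : Fin n → ℝ → ℝ := fun i t => overlap (ψ i) (u + (t : ℂ) • (w - u)) with ha
    have hcrit : ∀ s, ∑ i, p i * a i s * deriv (a i) s = 0 := fun s => by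
      have hder : HasDerivAt (fun t => ∑ i, p i * a i s * a i t)
          (∑ i, p i * a i s * deriv (a i) s) s :=
        HasDerivAt.fun_sum fun i _ => (hdiff i s).hasDerivAt.const_mul _
      refine IsLocalMax.hasDerivAt_eq_zero (Filter.Eventually.of_forall fun t => ?_) hder
      refine (hle _ _ (h s) (h t)).trans_eq (Finset.sum_congr rfl fun i _ => ?_)
      simp only [ha]
      ring
    have hder : ∀ s, HasDerivAt (fun t => ∑ i, p i * a i t ^ 2) 0 s := fun s => by
      have h1 : HasDerivAt (fun t => ∑ i, p i * a i t ^ 2)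
          (∑ i, p i * (2 * a i s ^ (2 - 1) * deriv (a i) s)) s :=
        HasDerivAt.fun_sum fun i _ => ((hdiff i s).hasDerivAt.pow 2).const_mul _
      convert h1 using 1
      rw [← mul_zero (2 : ℝ), ← hcrit s, Finset.mul_sum]
      exact Finset.sum_congr rfl fun i _ => by ring
    have := is_const_of_deriv_eq_zero (fun s => (hder s).differentiableAt)
      (fun s => (hder s).deriv) 0 1
    simpa [ha] using this
  · push Not at h
    obtain ⟨t, ht⟩ := h
    have ht1 : (1 - t : ℂ) ≠ 0 := fun h1 => hw (by
      have : (t : ℂ) = 1 := (sub_eq_zero.1 h1).symm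
      simpa [this] using ht)
    have ht2 : (1 - t : ℂ) • u = (-t : ℂ) • w := by
      rw [← sub_eq_zero, ← ht]
      module
    have ht0 : (-t : ℂ) ≠ 0 := fun h0 => by
      rw [h0, zero_smul] at ht2
      exact (smul_ne_zero ht1 hu) ht2
    refine Finset.sum_congr rfl fun i _ => ?_
    rw [← overlap_smul (ψ i) u ht1, ht2, overlap_smul (ψ i) w ht0]

/-! ### The second-moment operator -/

lemma swapMatrix_mul_self (d : ℕ) : swapMatrix d * swapMatrix d = 1 := by
  ext ⟨a, b⟩ ⟨a', b'⟩
  simp only [Matrix.mul_apply, swapMatrix, Matrix.of_apply, Fintype.sum_prod_type,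
    Matrix.one_apply, ite_and, Prod.mk.injEq]
  simp

lemma trace_swapMatrix (d : ℕ) : (swapMatrix d).trace = d := by
  simp only [Matrix.trace, Matrix.diag, swapMatrix, Matrix.of_apply, Fintype.sum_prod_type,
    ite_and]
  simp

lemma conjTranspose_swapMatrix (d : ℕ) : (swapMatrix d)ᴴ = swapMatrix d := by
  ext ⟨a, b⟩ ⟨a', b'⟩
  simp only [swapMatrix, conjTranspose_apply, Matrix.of_apply]
  by_cases h1 : a = b' <;> by_cases h2 : b = a' <;> simp [h1, h2, eq_comm]

lemma swapMatrix_mul_proj_kronecker {d : ℕ} (ψ : Fin d → ℂ) :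
    swapMatrix d * (proj ψ ⊗ₖ proj ψ) = proj ψ ⊗ₖ proj ψ := by
  ext ⟨a, b⟩ ⟨a', b'⟩
  simp only [Matrix.mul_apply, swapMatrix, Matrix.of_apply, Fintype.sum_prod_type, ite_and,
    kroneckerMap_apply, proj, vecMulVec_apply]
  simp
  ring

/-- An ensemble whose averaged fourth moment is that of a 2-design is a 2-design. -/
lemma design_of_sum_overlap {d n : ℕ} (hd : 0 < d)
    (ψ : Fin n → Fin d → ℂ) (hψ : ∀ i, vecNormSq (ψ i) = 1)
    (p : Fin n → ℝ) (hp1 : ∑ i, p i = 1)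
    (h : ∑ j, p j * ∑ i, p i * overlap (ψ i) (ψ j) ^ 2 = 2 / (d * (d + 1))) :
    ∑ i, (p i : ℂ) • (proj (ψ i) ⊗ₖ proj (ψ i)) =
      (1 / ((d : ℂ) * (d + 1))) • (1 + swapMatrix d) := by
  have hp1' : ∑ i, (p i : ℂ) = 1 := by exact_mod_cast hp1
  set T := ∑ i, (p i : ℂ) • (proj (ψ i) ⊗ₖ proj (ψ i)) with hT
  set S := swapMatrix d with hS
  set c : ℂ := 1 / ((d : ℂ) * (d + 1)) with hc
  have hTh : Tᴴ = T := by
    rw [hT, conjTranspose_sum]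
    refine Finset.sum_congr rfl fun i _ => ?_
    rw [conjTranspose_smul, conjTranspose_kronecker, (posSemidef_proj (ψ i)).isHermitian.eq]
    simp
  have hSh : Sᴴ = S := conjTranspose_swapMatrix d
  have hST : S * T = T := by
    rw [hT, Finset.mul_sum]
    refine Finset.sum_congr rfl fun i _ => ?_
    rw [Matrix.mul_smul, swapMatrix_mul_proj_kronecker]
  have hTS : T * S = T := by
    have := congrArg conjTranspose hST
    rwa [conjTranspose_mul, hTh, hSh] at this
  have hSS : S * S = 1 := swapMatrix_mul_self d
  have hcc : star c = c := by simp [hc]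
  have htT : T.trace = 1 := by
    rw [hT, trace_sum, ← hp1']
    refine Finset.sum_congr rfl fun i _ => ?_
    rw [trace_smul, trace_kronecker, trace_proj, hψ]
    simp
  have htTT : (T * T).trace = 2 * c := by
    have h' : ((∑ j, p j * ∑ i, p i * overlap (ψ i) (ψ j) ^ 2 : ℝ) : ℂ) = 2 * c := by
      rw [h, hc]; push_cast; ring
    rw [← h', hT, Finset.mul_sum, trace_sum]
    push_cast
    refine Finset.sum_congr rfl fun j _ => ?_
    rw [Finset.sum_mul, trace_sum, Finset.mul_sum]
    refine Finset.sum_congr rfl fun i _ => ?_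
    rw [Matrix.mul_smul, Matrix.smul_mul, trace_smul, trace_smul, ← mul_kronecker_mul,
      trace_kronecker, trace_proj_mul_proj, overlap, hψ]
    simp [pow_two]
  have hDD : (T - c • (1 + S)) * (T - c • (1 + S)) =
      T * T - (4 * c) • T + (2 * c ^ 2) • (1 + S) := by
    simp only [sub_mul, mul_sub, Matrix.smul_mul, Matrix.mul_smul, mul_add, add_mul, mul_one,
      one_mul, hST, hTS, hSS]
    module
  have hD : (T - c • (1 + S))ᴴ = T - c • (1 + S) := by
    rw [conjTranspose_sub, conjTranspose_smul, conjTranspose_add, conjTranspose_one, hTh, hSh, hcc]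
  rw [← sub_eq_zero, ← trace_conjTranspose_mul_self_eq_zero_iff, hD, hDD, trace_add, trace_sub,
    trace_smul, trace_smul, trace_add, htTT, htT, trace_one, hS, trace_swapMatrix]
  have h1 : (d : ℂ) ≠ 0 := by exact_mod_cast hd.ne'
  have h2 : (d : ℂ) + 1 ≠ 0 := by exact_mod_cast d.succ_ne_zero
  simp only [hc, smul_eq_mul, Fintype.card_prod, Fintype.card_fin]
  push_cast
  field_simp
  ring

/-- **converse part of Theorem 2.** If an ensemble is not a
generalized 2-design, then some POVM together with some family of
reconstruction density matrices achieves average fidelity strictly greater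
than `2/(d+1)`. -/
theorem exists_strategy_beating_bound_of_not_design {d n : ℕ}
    (ψ : Fin n → Fin d → ℂ) (hψ : ∀ i, star (ψ i) ⬝ᵥ ψ i = 1)
    (p : Fin n → ℝ) (hp : ∀ i, 0 ≤ p i) (hp1 : ∑ i, p i = 1)
    (hnotdesign : ∑ i, (p i : ℂ) • (proj (ψ i) ⊗ₖ proj (ψ i)) ≠
      (1 / ((d : ℂ) * (d + 1))) • (1 + swapMatrix d)) :
    ∃ (m : ℕ) (E : Fin m → Matrix (Fin d) (Fin d) ℂ)
      (σ : Fin m → Matrix (Fin d) (Fin d) ℂ),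
      (∀ b, (E b).PosSemidef) ∧ (∑ b, E b = 1) ∧
      (∀ b, (σ b).PosSemidef) ∧ (∀ b, (σ b).trace = 1) ∧
      2 / ((d : ℝ) + 1) <
        ∑ b, ∑ i, p i * (proj (ψ i) * E b).trace.re * (proj (ψ i) * σ b).trace.re := by
  have hψ' : ∀ i, vecNormSq (ψ i) = 1 := fun i => by
    exact_mod_cast (ofReal_vecNormSq (ψ i)).trans (hψ i)
  have hd : 0 < d := by
    rcases Nat.eq_zero_or_pos d with rfl | hd
    · have hn : IsEmpty (Fin n) := ⟨fun i => by simpa [vecNormSq] using hψ' i⟩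
      simp at hp1
    · exact hd
  by_contra hno
  have hle : ∀ x y : Fin d → ℂ, x ≠ 0 → y ≠ 0 →
      ∑ i, p i * overlap (ψ i) x * overlap (ψ i) y ≤ ∑ i, p i * overlap (ψ i) x ^ 2 :=
    fun x y hx hy => sum_overlap_mul_le hd ψ hψ' p hp1 hno hx hy
  have hψ0 : ∀ i, ψ i ≠ 0 := fun i h0 => by
    have := hψ' i
    simp [h0, vecNormSq] at this
  have hval : ∀ x : Fin d → ℂ, x ≠ 0 →
      ∑ i, p i * overlap (ψ i) x ^ 2 = 2 / (d * (d + 1)) := fun x hx => by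
    have hsum : ∑ s, designWeight d s * vecNormSq (designVec d s) *
        ∑ i, p i * overlap (ψ i) (designVec d s) ^ 2 = 2 / (d + 1) := by
      simp only [Finset.mul_sum]
      rw [Finset.sum_comm, show 2 / ((d : ℝ) + 1) = (∑ i, p i) * (2 / (d + 1)) by rw [hp1, one_mul],
        Finset.sum_mul]
      refine Finset.sum_congr rfl fun i _ => ?_
      have hi := sum_design_overlap hd (ψ i)
      rw [hψ' i, one_pow, mul_one] at hi
      rw [← hi, Finset.mul_sum]
      refine Finset.sum_congr rfl fun s _ => ?_
      have := (vecNormSq_pos (designVec_ne_zero hd s)).ne'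
      simp only [overlap]
      field_simp
    have hconst : ∀ s, ∑ i, p i * overlap (ψ i) (designVec d s) ^ 2 =
        ∑ i, p i * overlap (ψ i) x ^ 2 := fun s =>
      sum_overlap_sq_const ψ p hle (designVec_ne_zero hd s) hx
    simp only [hconst] at hsum
    rw [← Finset.sum_mul, sum_designWeight_vecNormSq] at hsum
    have h0 : (0 : ℝ) < d := by exact_mod_cast hd
    field_simp at hsum ⊢
    linarith
  refine hnotdesign (design_of_sum_overlap hd ψ hψ' p hp1 ?_)
  simp only [hval _ (hψ0 _)]
  rw [← Finset.sum_mul, hp1, one_mul]
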